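/- Fix n, p ∈ ℕ, vectors h, w* ∈ ℝ^p, κ ≥ 0, a convex function ψ : ℝ^p → ℝ, and a measurable link ρ : ℝ → [0,1]; let c_κ(α,σ) = ∫∫ [ρ(κz₁)·((1 − κ·α·z₁ − σ·z₂)₊)² + (1 − ρ(κz₁))·((1 + κ·α·z₁ − σ·z₂)₊)²] dγ(z₁)dγ(z₂) with γ the standard Gaussian measure on ℝ. Define f(α, σ, u; γ', β, τ, v) = (1/p)·ψ(u) + β·√(c_κ(α,σ)) + (1/p)·⟨v, u − α·w*⟩ − σ·τ/2 − (σ/(2τ))·‖(β/√n)·h − (1/√p)·v + (γ'/√p)·w*‖². Then: (i) for every fixed (γ', β, τ, v) with β ≥ 0, σ ≥ 0 and τ > 0, the function (α, σ, u) ↦ f is jointly convex on ℝ × [0,∞) × ℝ^p; and (ii) for every fixed (α, σ, u) with σ ≥ 0, the function (γ', β, τ, v) ↦ f is jointly concave on ℝ × [0,∞) × (0,∞) × ℝ^p. -/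

import Mathlib

open MeasureTheory ProbabilityTheory

/-- The summary functional `c_κ(α,σ)` for a general link function `ρ`. -/
noncomputable def summaryFunctional (ρ : ℝ → ℝ) (κ α σ : ℝ) : ℝ :=
  ∫ z₁, ∫ z₂,
    (ρ (κ * z₁) * (max (1 - κ * α * z₁ - σ * z₂) 0) ^ 2
      + (1 - ρ (κ * z₁)) * (max (1 + κ * α * z₁ - σ * z₂) 0) ^ 2)
    ∂(gaussianReal 0 1) ∂(gaussianReal 0 1)

/-- The objective of the CGMT auxiliary optimization for the GMM problem:
`f(α, σ, u; γ', β, τ, v) = (1/p)ψ(u) + β√(c_κ(α,σ)) + (1/p)⟨v, u - α w*⟩ - στ/2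
  - (σ/(2τ))‖(β/√n)h - v/√p + (γ'/√p)w*‖²`. -/
noncomputable def auxObjective (n p : ℕ) (h wstar : Fin p → ℝ) (κ : ℝ)
    (ψ : (Fin p → ℝ) → ℝ) (ρ : ℝ → ℝ)
    (α σ : ℝ) (u : Fin p → ℝ) (γ' β τ : ℝ) (v : Fin p → ℝ) : ℝ :=
  (1 / (p : ℝ)) * ψ u + β * Real.sqrt (summaryFunctional ρ κ α σ)
    + (1 / (p : ℝ)) * ∑ i, v i * (u i - α * wstar i)
    - σ * τ / 2
    - (σ / (2 * τ)) * ∑ i,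
        ((β / Real.sqrt n) * h i - (1 / Real.sqrt p) * v i
          + (γ' / Real.sqrt p) * wstar i) ^ 2

/-- Joint convexity of `(x, s) ↦ x ^ 2 / s` for `s > 0`, cleared of the outer denominator. -/
lemma sq_convexComb_le_mul {a b x y s t : ℝ} (ha : 0 ≤ a) (hb : 0 ≤ b) (hs : 0 < s)
    (ht : 0 < t) :
    (a * x + b * y) ^ 2 ≤ (a * s + b * t) * (a * (x ^ 2 / s) + b * (y ^ 2 / t)) := by
  have key : (a * s + b * t) * (a * (x ^ 2 / s) + b * (y ^ 2 / t)) - (a * x + b * y) ^ 2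
      = a * b * (s * t) * (x / s - y / t) ^ 2 := by
    field_simp
    ring
  have : 0 ≤ a * b * (s * t) * (x / s - y / t) ^ 2 := by positivity
  linarith

/-- The integrand of `summaryFunctional`, as a function on the plane. -/
noncomputable def summaryIntegrand (ρ : ℝ → ℝ) (κ α σ : ℝ) (z : ℝ × ℝ) : ℝ :=
  ρ (κ * z.1) * (max (1 - κ * α * z.1 - σ * z.2) 0) ^ 2
    + (1 - ρ (κ * z.1)) * (max (1 + κ * α * z.1 - σ * z.2) 0) ^ 2

lemma integrable_sq_max_affine (c d : ℝ) :
    Integrable (fun z : ℝ × ℝ => (max (1 + c * z.1 - d * z.2) 0) ^ 2)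
      ((gaussianReal 0 1).prod (gaussianReal 0 1)) := by
  have hid : MemLp (id : ℝ → ℝ) 2 (gaussianReal 0 1) :=
    memLp_id_gaussianReal' 2 (by simp)
  have h1 : MemLp (fun z : ℝ × ℝ => c * z.1) 2
      ((gaussianReal 0 1).prod (gaussianReal 0 1)) := (hid.comp_fst _).const_mul c
  have h2 : MemLp (fun z : ℝ × ℝ => d * z.2) 2
      ((gaussianReal 0 1).prod (gaussianReal 0 1)) := (hid.comp_snd _).const_mul d
  have h3 : MemLp (fun z : ℝ × ℝ => 1 + c * z.1 - d * z.2) 2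
      ((gaussianReal 0 1).prod (gaussianReal 0 1)) := ((memLp_const (1 : ℝ)).add h1).sub h2
  have h4 : MemLp (fun z : ℝ × ℝ => max (1 + c * z.1 - d * z.2) 0) 2
      ((gaussianReal 0 1).prod (gaussianReal 0 1)) := h3.pos_part
  exact h4.integrable_sq

lemma integrable_summaryIntegrand {ρ : ℝ → ℝ} (hρmeas : Measurable ρ)
    (hρ : ∀ t, ρ t ∈ Set.Icc (0 : ℝ) 1) (κ α σ : ℝ) :
    Integrable (summaryIntegrand ρ κ α σ)
      ((gaussianReal 0 1).prod (gaussianReal 0 1)) := by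
  have hm : Measurable fun z : ℝ × ℝ => ρ (κ * z.1) := by fun_prop
  have h1 := (integrable_sq_max_affine (-(κ * α)) σ).bdd_mul (c := 1)
    hm.aestronglyMeasurable (Filter.Eventually.of_forall fun z => by
      rw [Real.norm_eq_abs, abs_le]
      constructor <;> linarith [(hρ (κ * z.1)).1, (hρ (κ * z.1)).2])
  have h2 := (integrable_sq_max_affine (κ * α) σ).bdd_mul (c := 1)
    (hm.const_sub 1).aestronglyMeasurable (Filter.Eventually.of_forall fun z => by
      rw [Real.norm_eq_abs, abs_le]
      constructor <;> linarith [(hρ (κ * z.1)).1, (hρ (κ * z.1)).2])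
  refine (h1.add h2).congr (Filter.Eventually.of_forall fun z => ?_)
  simp only [summaryIntegrand, Pi.add_apply, neg_mul, ← sub_eq_add_neg]

lemma summaryFunctional_eq_integral_prod {ρ : ℝ → ℝ} (hρmeas : Measurable ρ)
    (hρ : ∀ t, ρ t ∈ Set.Icc (0 : ℝ) 1) (κ α σ : ℝ) :
    summaryFunctional ρ κ α σ
      = ∫ z, summaryIntegrand ρ κ α σ z ∂((gaussianReal 0 1).prod (gaussianReal 0 1)) :=
  (integral_prod _ (integrable_summaryIntegrand hρmeas hρ κ α σ)).symm

lemma summaryIntegrand_nonneg {ρ : ℝ → ℝ} (hρ : ∀ t, ρ t ∈ Set.Icc (0 : ℝ) 1)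
    (κ α σ : ℝ) (z : ℝ × ℝ) : 0 ≤ summaryIntegrand ρ κ α σ z := by
  have h0 := (hρ (κ * z.1)).1
  have h1 : 0 ≤ 1 - ρ (κ * z.1) := by linarith [(hρ (κ * z.1)).2]
  unfold summaryIntegrand
  positivity

lemma sq_max_convexComb_le {a b x y : ℝ} (ha : 0 ≤ a) (hb : 0 ≤ b) :
    (max (a * x + b * y) 0) ^ 2 ≤ (a * max x 0 + b * max y 0) ^ 2 := by
  refine pow_le_pow_left₀ (le_max_right _ _) (max_le ?_ (by positivity)) 2
  gcongr <;> exact le_max_left _ _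

lemma summaryIntegrand_convexComb_le {ρ : ℝ → ℝ} (hρ : ∀ t, ρ t ∈ Set.Icc (0 : ℝ) 1)
    (κ : ℝ) {a b s t : ℝ} (ha : 0 ≤ a) (hb : 0 ≤ b) (hab : a + b = 1) (hs : 0 < s) (ht : 0 < t)
    (α₁ σ₁ α₂ σ₂ : ℝ) (z : ℝ × ℝ) :
    summaryIntegrand ρ κ (a * α₁ + b * α₂) (a * σ₁ + b * σ₂) z
      ≤ (a * s + b * t) * (a / s) * summaryIntegrand ρ κ α₁ σ₁ z
        + (a * s + b * t) * (b / t) * summaryIntegrand ρ κ α₂ σ₂ z := by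
  have h0 := (hρ (κ * z.1)).1
  have h1 : 0 ≤ 1 - ρ (κ * z.1) := by linarith [(hρ (κ * z.1)).2]
  have hminus : 1 - κ * (a * α₁ + b * α₂) * z.1 - (a * σ₁ + b * σ₂) * z.2
      = a * (1 - κ * α₁ * z.1 - σ₁ * z.2) + b * (1 - κ * α₂ * z.1 - σ₂ * z.2) := by
    linear_combination -hab
  have hplus : 1 + κ * (a * α₁ + b * α₂) * z.1 - (a * σ₁ + b * σ₂) * z.2
      = a * (1 + κ * α₁ * z.1 - σ₁ * z.2) + b * (1 + κ * α₂ * z.1 - σ₂ * z.2) := by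
    linear_combination -hab
  have bound (x y : ℝ) := (sq_max_convexComb_le (x := x) (y := y) ha hb).trans
    (sq_convexComb_le_mul ha hb hs ht)
  unfold summaryIntegrand
  rw [hminus, hplus]
  refine (add_le_add (mul_le_mul_of_nonneg_left (bound _ _) h0)
    (mul_le_mul_of_nonneg_left (bound _ _) h1)).trans_eq ?_
  ring

/-- `(α, σ) ↦ √(c_κ(α,σ))` is jointly convex. -/
lemma convexOn_sqrt_summaryFunctional {ρ : ℝ → ℝ} (hρmeas : Measurable ρ)
    (hρ : ∀ t, ρ t ∈ Set.Icc (0 : ℝ) 1) (κ : ℝ) :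
    ConvexOn ℝ Set.univ (fun q : ℝ × ℝ => √(summaryFunctional ρ κ q.1 q.2)) := by
  refine ⟨convex_univ, ?_⟩
  rintro ⟨α₁, σ₁⟩ - ⟨α₂, σ₂⟩ - a b ha hb hab
  simp only [Prod.fst_add, Prod.snd_add, Prod.smul_fst, Prod.smul_snd, smul_eq_mul]
  have hI := integrable_summaryIntegrand hρmeas hρ κ
  have hnn (α σ : ℝ) : 0 ≤ summaryFunctional ρ κ α σ := by
    rw [summaryFunctional_eq_integral_prod hρmeas hρ]
    exact integral_nonneg (summaryIntegrand_nonneg hρ κ α σ)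
  refine le_of_forall_pos_le_add fun ε hε => ?_
  set s := √(summaryFunctional ρ κ α₁ σ₁) + ε with hs
  set t := √(summaryFunctional ρ κ α₂ σ₂) + ε with ht
  have hs0 : 0 < s := by positivity
  have ht0 : 0 < t := by positivity
  have hle : summaryFunctional ρ κ (a * α₁ + b * α₂) (a * σ₁ + b * σ₂)
      ≤ (a * s + b * t) * (a / s) * summaryFunctional ρ κ α₁ σ₁
        + (a * s + b * t) * (b / t) * summaryFunctional ρ κ α₂ σ₂ := by
    simp only [summaryFunctional_eq_integral_prod hρmeas hρ]
    rw [← integral_const_mul, ← integral_const_mul,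
      ← integral_add ((hI _ _).const_mul _) ((hI _ _).const_mul _)]
    exact integral_mono (hI _ _) (((hI _ _).const_mul _).add ((hI _ _).const_mul _))
      (summaryIntegrand_convexComb_le hρ κ ha hb hab hs0 ht0 α₁ σ₁ α₂ σ₂)
  have hsq (α σ : ℝ) : summaryFunctional ρ κ α σ ≤ (√(summaryFunctional ρ κ α σ) + ε) ^ 2 :=
    (Real.sq_sqrt (hnn α σ)).ge.trans (by gcongr; linarith)
  have hle' : summaryFunctional ρ κ (a * α₁ + b * α₂) (a * σ₁ + b * σ₂)
      ≤ (a * s + b * t) ^ 2 := by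
    refine hle.trans ?_
    calc _ ≤ (a * s + b * t) * (a / s) * s ^ 2 + (a * s + b * t) * (b / t) * t ^ 2 := by
          gcongr
          · exact hsq α₁ σ₁
          · exact hsq α₂ σ₂
      _ = (a * s + b * t) ^ 2 := by
          field_simp
  calc _ ≤ a * s + b * t := Real.sqrt_le_iff.2 ⟨by positivity, hle'⟩
    _ = _ := by
      rw [hs, ht]
      linear_combination ε * hab

/-- `(τ, x) ↦ ‖x‖² / τ` is jointly convex for `τ > 0`. -/
lemma sum_sq_div_convexComb_le {ι : Type*} [Fintype ι] {a b s t : ℝ} (ha : 0 ≤ a) (hb : 0 ≤ b)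
    (hab : a + b = 1) (hs : 0 < s) (ht : 0 < t) (x y : ι → ℝ) :
    (∑ i, (a * x i + b * y i) ^ 2) / (a * s + b * t)
      ≤ a * ((∑ i, x i ^ 2) / s) + b * ((∑ i, y i ^ 2) / t) := by
  have hpos : 0 < a * s + b * t := by
    simpa using (convex_Ioi (0 : ℝ)) hs ht ha hb hab
  rw [div_le_iff₀' hpos]
  refine (Finset.sum_le_sum fun i _ => sq_convexComb_le_mul ha hb hs ht).trans_eq ?_
  rw [← Finset.mul_sum, Finset.sum_add_distrib, ← Finset.mul_sum, ← Finset.mul_sum,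
    ← Finset.sum_div, ← Finset.sum_div]

/-- The auxiliary objective is jointly convex in `(α, σ, u)` on `ℝ × [0,∞) × ℝ^p`
for each fixed `(γ', β, τ, v)` with `β ≥ 0`, `τ > 0`, and jointly concave in
`(γ', β, τ, v)` on `ℝ × [0,∞) × (0,∞) × ℝ^p` for each fixed `(α, σ, u)` with `σ ≥ 0`. -/
theorem auxObjective_convex_concave (n p : ℕ) (h wstar : Fin p → ℝ)
    (κ : ℝ) (hκ : 0 ≤ κ)
    (ψ : (Fin p → ℝ) → ℝ) (hψ : ConvexOn ℝ Set.univ ψ)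
    (ρ : ℝ → ℝ) (hρmeas : Measurable ρ) (hρ : ∀ t, ρ t ∈ Set.Icc (0 : ℝ) 1) :
    (∀ (γ' β τ : ℝ) (v : Fin p → ℝ), 0 ≤ β → 0 < τ →
      ConvexOn ℝ (Set.univ ×ˢ (Set.Ici (0 : ℝ)) ×ˢ Set.univ)
        (fun q : ℝ × ℝ × (Fin p → ℝ) =>
          auxObjective n p h wstar κ ψ ρ q.1 q.2.1 q.2.2 γ' β τ v)) ∧
    (∀ (α σ : ℝ) (u : Fin p → ℝ), 0 ≤ σ →
      ConcaveOn ℝ (Set.univ ×ˢ (Set.Ici (0 : ℝ)) ×ˢ (Set.Ioi (0 : ℝ)) ×ˢ Set.univ)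
        (fun q : ℝ × ℝ × ℝ × (Fin p → ℝ) =>
          auxObjective n p h wstar κ ψ ρ α σ u q.1 q.2.1 q.2.2.1 q.2.2.2)) := by
  constructor
  · intro γ' β τ v hβ hτ
    refine ⟨convex_univ.prod ((convex_Ici 0).prod convex_univ), ?_⟩
    rintro ⟨α₁, σ₁, u₁⟩ - ⟨α₂, σ₂, u₂⟩ - a b ha hb hab
    have hψ' := hψ.2 (Set.mem_univ u₁) (Set.mem_univ u₂) ha hb hab
    have hc := (convexOn_sqrt_summaryFunctional hρmeas hρ κ).2
      (Set.mem_univ (α₁, σ₁)) (Set.mem_univ (α₂, σ₂)) ha hb hab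
    have hlin : ∑ i, v i * (a * u₁ i + b * u₂ i - (a * α₁ + b * α₂) * wstar i)
        = a * ∑ i, v i * (u₁ i - α₁ * wstar i) + b * ∑ i, v i * (u₂ i - α₂ * wstar i) := by
      simp only [Finset.mul_sum, ← Finset.sum_add_distrib]
      exact Finset.sum_congr rfl fun i _ => by ring
    simp only [auxObjective, Prod.fst_add, Prod.snd_add, Prod.smul_fst, Prod.smul_snd,
      smul_eq_mul, Pi.add_apply, Pi.smul_apply] at hψ' hc ⊢
    rw [hlin]
    have h1 := mul_le_mul_of_nonneg_left hψ' (by positivity : 0 ≤ 1 / (p : ℝ))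
    have h2 := mul_le_mul_of_nonneg_left hc hβ
    refine (sub_le_sub_right (sub_le_sub_right (add_le_add_left (add_le_add h1 h2) _) _) _).trans_eq
      ?_
    ring
  · intro α σ u hσ
    refine ⟨convex_univ.prod ((convex_Ici 0).prod ((convex_Ioi 0).prod convex_univ)), ?_⟩
    rintro ⟨γ₁, β₁, τ₁, v₁⟩ ⟨-, -, hτ₁, -⟩ ⟨γ₂, β₂, τ₂, v₂⟩ ⟨-, -, hτ₂, -⟩ a b ha hb hab
    have hlin : ∑ i, (a * v₁ i + b * v₂ i) * (u i - α * wstar i)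
        = a * ∑ i, v₁ i * (u i - α * wstar i) + b * ∑ i, v₂ i * (u i - α * wstar i) := by
      simp only [Finset.mul_sum, ← Finset.sum_add_distrib]
      exact Finset.sum_congr rfl fun i _ => by ring
    have hq := sum_sq_div_convexComb_le ha hb hab hτ₁ hτ₂
      (fun i => (β₁ / √n) * h i - (1 / √p) * v₁ i + (γ₁ / √p) * wstar i)
      (fun i => (β₂ / √n) * h i - (1 / √p) * v₂ i + (γ₂ / √p) * wstar i)
    have hres : ∑ i, (((a * β₁ + b * β₂) / √n) * h i - (1 / √p) * (a * v₁ i + b * v₂ i)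
          + ((a * γ₁ + b * γ₂) / √p) * wstar i) ^ 2
        = ∑ i, (a * ((β₁ / √n) * h i - (1 / √p) * v₁ i + (γ₁ / √p) * wstar i)
          + b * ((β₂ / √n) * h i - (1 / √p) * v₂ i + (γ₂ / √p) * wstar i)) ^ 2 :=
      Finset.sum_congr rfl fun i _ => by ring
    have hdiv (τ S : ℝ) : σ / (2 * τ) * S = σ / 2 * (S / τ) := by ring
    simp only [auxObjective, Prod.fst_add, Prod.snd_add, Prod.smul_fst, Prod.smul_snd,
      smul_eq_mul, Pi.add_apply, Pi.smul_apply, hdiv]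
    rw [hlin, hres]
    have h1 := mul_le_mul_of_nonneg_left hq (by positivity : 0 ≤ σ / 2)
    refine le_trans (le_of_eq ?_) (sub_le_sub_left h1 _)
    linear_combination (1 / (p : ℝ) * ψ u) * hab
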